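/- There is a ring isomorphism from ℤ[w,z]/(w² − 2w, w − 2z + z²) to ℤ[t]/(t⁴ − 1) sending the class of w to the class of 1 − t² and the class of z to the class of 1 − t. -/

import Mathlib

open MvPolynomial

/-- The ideal `(w² - 2w, w - 2z + z²)` of `ℤ[w,z]`, where `w = X 0`, `z = X 1`. -/
noncomputable def reprIdeal : Ideal (MvPolynomial (Fin 2) ℤ) :=
  Ideal.span {(X 0 : MvPolynomial (Fin 2) ℤ) ^ 2 - 2 * X 0,
    (X 0 : MvPolynomial (Fin 2) ℤ) - 2 * X 1 + (X 1) ^ 2}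

/-- The ideal `(t⁴ - 1)` of `ℤ[t]`. -/
noncomputable def tIdeal : Ideal (Polynomial ℤ) :=
  Ideal.span {(Polynomial.X : Polynomial ℤ) ^ 4 - 1}

/-- The ring homomorphism `ℤ[w,z]/(w² - 2w, w - 2z + z²) → ℤ[t]/(t⁴ - 1)` with `w ↦ 1 - t²` and
`z ↦ 1 - t`. -/
noncomputable def reprToT : (MvPolynomial (Fin 2) ℤ ⧸ reprIdeal) →+* (Polynomial ℤ ⧸ tIdeal) :=
  Ideal.quotientMap tIdeal
    (aeval ![1 - Polynomial.X ^ 2, 1 - Polynomial.X] :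
      MvPolynomial (Fin 2) ℤ →ₐ[ℤ] Polynomial ℤ).toRingHom <| by
    rw [reprIdeal, Ideal.span_le]
    rintro p (rfl | rfl)
    · refine Ideal.mem_span_singleton'.2 ⟨1, ?_⟩
      simp
      ring
    · refine Ideal.mem_span_singleton'.2 ⟨0, ?_⟩
      simp
      ring

/-- The ring homomorphism `ℤ[t]/(t⁴ - 1) → ℤ[w,z]/(w² - 2w, w - 2z + z²)` with `t ↦ 1 - z`. -/
noncomputable def tToRepr : (Polynomial ℤ ⧸ tIdeal) →+* (MvPolynomial (Fin 2) ℤ ⧸ reprIdeal) :=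
  Ideal.quotientMap reprIdeal
    (Polynomial.aeval (1 - X 1) : Polynomial ℤ →ₐ[ℤ] MvPolynomial (Fin 2) ℤ).toRingHom <| by
    rw [tIdeal, Ideal.span_singleton_le_iff_mem]
    refine Ideal.mem_span_pair.2 ⟨1, 2 * (1 - X 0) + (X 0 - 2 * X 1 + X 1 ^ 2), ?_⟩
    simp
    ring

theorem reprToT_mk_X_zero :
    reprToT (Ideal.Quotient.mk reprIdeal (X 0)) =
      Ideal.Quotient.mk tIdeal (1 - Polynomial.X ^ 2) := by
  simp [reprToT]

theorem reprToT_mk_X_one :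
    reprToT (Ideal.Quotient.mk reprIdeal (X 1)) =
      Ideal.Quotient.mk tIdeal (1 - Polynomial.X) := by
  simp [reprToT]

theorem tToRepr_mk_X :
    tToRepr (Ideal.Quotient.mk tIdeal Polynomial.X) =
      Ideal.Quotient.mk reprIdeal (1 - X 1) := by
  simp [tToRepr]

theorem reprToT_comp_tToRepr : reprToT.comp tToRepr = RingHom.id _ := by
  refine Ideal.Quotient.ringHom_ext (Polynomial.ringHom_ext' (RingHom.ext_int _ _) ?_)
  simp [tToRepr_mk_X, reprToT_mk_X_one]

theorem tToRepr_comp_reprToT : tToRepr.comp reprToT = RingHom.id _ := by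
  refine Ideal.Quotient.ringHom_ext (MvPolynomial.ringHom_ext' (RingHom.ext_int _ _) fun i => ?_)
  fin_cases i
  · have h : Ideal.Quotient.mk reprIdeal (1 - (1 - X 1) ^ 2) =
        Ideal.Quotient.mk reprIdeal (X 0) :=
      Ideal.Quotient.eq.2 (Ideal.mem_span_pair.2 ⟨0, -1, by ring⟩)
    simpa [tToRepr_mk_X, reprToT_mk_X_zero] using h
  · simp [tToRepr_mk_X, reprToT_mk_X_one]

/-- There is a ring isomorphism `ℤ[w,z]/(w² - 2w, w - 2z + z²) ≃ ℤ[t]/(t⁴ - 1)`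
sending `w ↦ 1 - t²` and `z ↦ 1 - t`. -/
theorem repr_ring_iso :
    ∃ e : (MvPolynomial (Fin 2) ℤ ⧸ reprIdeal) ≃+* (Polynomial ℤ ⧸ tIdeal),
      e (Ideal.Quotient.mk reprIdeal (X 0)) =
        Ideal.Quotient.mk tIdeal (1 - Polynomial.X ^ 2) ∧
      e (Ideal.Quotient.mk reprIdeal (X 1)) =
        Ideal.Quotient.mk tIdeal (1 - Polynomial.X) := by
  exact ⟨RingEquiv.ofRingHom reprToT tToRepr reprToT_comp_tToRepr tToRepr_comp_reprToT,
    reprToT_mk_X_zero, reprToT_mk_X_one⟩
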